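/- Let S be a positive Markov martingale with kernel K and default function M_S. If M_S(x) = 0 for all x ≥ x' for some x' > 0, then M_S ≡ 0 on (0,∞) and P_x is not a bubble measure for S for any x > 0. -/

import Mathlib

open MeasureTheory Filter Set

noncomputable section

variable {Ω : Type*}

/-- Evaluation of a discrete-time process at a possibly infinite random time `τ`,
using the limit variable `Sinf` on the event `{τ = ∞}`. -/
def evalAt (S : ℕ → Ω → ℝ) (Sinf : Ω → ℝ) (τ : Ω → ℕ∞) (ω : Ω) : ℝ :=
  if τ ω = ⊤ then Sinf ω else S (τ ω).toNat ω

/-- The `k`-th drawdown time of `S`: `τ₀ = 0` and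
`τ_k = inf {j > τ_{k-1} : S_j < S_{j-1}}` (with value `∞` if no such `j` exists). -/
def drawdown (S : ℕ → Ω → ℝ) : ℕ → Ω → ℕ∞
  | 0 => fun _ => 0
  | (k + 1) => fun ω =>
      sInf {j : ℕ∞ | drawdown S k ω < j ∧ ∃ n : ℕ, j = (n : ℕ∞) ∧ S n ω < S (n - 1) ω}

/-- The first drawdown of `S` after the deterministic time `k`:
`τ̃_k = inf {j > k : S_j < S_{j-1}}`. -/
def drawdownAfter (S : ℕ → Ω → ℝ) (k : ℕ) (ω : Ω) : ℕ∞ :=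
  sInf {j : ℕ∞ | (k : ℕ∞) < j ∧ ∃ n : ℕ, j = (n : ℕ∞) ∧ S n ω < S (n - 1) ω}

/-- The process stopped at a possibly infinite random time. -/
def stoppedAt (S : ℕ → Ω → ℝ) (τ : Ω → ℕ∞) (n : ℕ) (ω : Ω) : ℝ :=
  S ((min (n : ℕ∞) (τ ω)).toNat) ω

/-- The event `{S_k ≤ S_{k+1} ≤ ⋯ ≤ S_n}`. -/
def monoEvent (S : ℕ → Ω → ℝ) (k n : ℕ) : Set Ω :=
  {ω | ∀ j, k ≤ j → j < n → S j ω ≤ S (j + 1) ω}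

/-- `S` is a bubble under `P`: it loses mass at its `k`-th drawdown time for some `k ≥ 1`. -/
def IsBubble [MeasurableSpace Ω] (S : ℕ → Ω → ℝ) (Sinf : Ω → ℝ) (P : Measure Ω) : Prop :=
  ∃ k : ℕ, ∫ ω, evalAt S Sinf (drawdown S (k + 1)) ω ∂P < ∫ ω, S 0 ω ∂P

end

noncomputable section

open ProbabilityTheory

/-- A positive time-homogeneous Markov martingale on `(0, ∞)` with transition kernel `K`,
together with its family of laws `P x` (start at `x`) and the a.s. limit `Sinf`. -/
structure MarkovMartingale (Ω : Type*) [m0 : MeasurableSpace Ω] where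
  P : ℝ → Measure Ω
  F : Filtration ℕ m0
  S : ℕ → Ω → ℝ
  Sinf : Ω → ℝ
  K : Kernel ℝ ℝ
  markov : IsMarkovKernel K
  prob : ∀ x, 0 < x → IsProbabilityMeasure (P x)
  pos : ∀ x, 0 < x → ∀ᵐ ω ∂P x, ∀ n, 0 < S n ω
  start : ∀ x, 0 < x → ∀ᵐ ω ∂P x, S 0 ω = x
  mart : ∀ x, 0 < x → Martingale S F (P x)
  conv : ∀ x, 0 < x → ∀ᵐ ω ∂P x, Tendsto (fun n => S n ω) atTop (nhds (Sinf ω))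
  kernel_pos : ∀ x, 0 < x → K x (Set.Iic 0) = 0
  kernel_int : ∀ x, 0 < x → Integrable id (K x)
  kernel_mart : ∀ x, 0 < x → ∫ y, y ∂(K x) = x
  step : ∀ x, 0 < x → ∀ n : ℕ, ∀ g : ℝ → ℝ, Measurable g → (∃ C, ∀ y, |g y| ≤ C) →
    (P x)[fun ω => g (S (n + 1) ω) | F n] =ᵐ[P x] fun ω => ∫ y, g y ∂(K (S n ω))

namespace MarkovMartingale

variable {Ω : Type*} [MeasurableSpace Ω]

/-- The probability `a(x) = K(x, [0,x))` of a downward move from `x`. -/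
def a (M : MarkovMartingale Ω) (x : ℝ) : ℝ := (M.K x (Set.Ico 0 x)).toReal

/-- The relative recovery `b(x) = (1/x) ∫_{[0,x)} y K(x,dy)` upon a downward move. -/
def b (M : MarkovMartingale Ω) (x : ℝ) : ℝ := (1 / x) * ∫ y in Set.Ico 0 x, y ∂(M.K x)

/-- The relaxed relative recovery `b_ε(x) = (1/x) ∫_{[0,x(1+ε))} y K(x,dy)`. -/
def bEps (M : MarkovMartingale Ω) (ε x : ℝ) : ℝ :=
  (1 / x) * ∫ y in Set.Ico 0 (x * (1 + ε)), y ∂(M.K x)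

/-- `S` is a bubble under `P_x`. -/
def Bubble (M : MarkovMartingale Ω) (x : ℝ) : Prop := IsBubble M.S M.Sinf (M.P x)

/-- `S` is `P_x`-a.s. bounded. -/
def Bounded (M : MarkovMartingale Ω) (x : ℝ) : Prop :=
  ∃ C : ℝ, ∀ᵐ ω ∂M.P x, ∀ n, M.S n ω ≤ C

/-- The default function `M_S(x) = x - E_x[S_{τ₁}]`, the loss of mass at the first
drawdown. -/
def defaultFn (M : MarkovMartingale Ω) (x : ℝ) : ℝ :=
  x - ∫ ω, evalAt M.S M.Sinf (drawdown M.S 1) ω ∂(M.P x)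

/-- The assumption that the downward-move probability `a` is locally bounded away from zero
above a level `xa`. -/
def ALowerBound (M : MarkovMartingale Ω) (xa : ℝ) : Prop :=
  0 < xa ∧ ∀ y, xa < y → ∃ c > (0 : ℝ), ∀ x ∈ Set.Icc xa y, c ≤ M.a x

end MarkovMartingale

end

namespace MarkovMartingale

open scoped ENNReal
open ProbabilityTheory Topology

/-- The kernel operator `f ↦ ∫ f(y) 1_{y ≥ x, y ∈ s} K(x, dy)`: the expectation of `f` after one
step that does not move down and lands in `s`. -/
noncomputable def upStep (K : Kernel ℝ ℝ) (s : Set ℝ) (f : ℝ → ℝ≥0∞) (x : ℝ) : ℝ≥0∞ :=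
  ∫⁻ y in Ici x ∩ s, f y ∂(K x)

section upStep

variable {K : Kernel ℝ ℝ} {s : Set ℝ} {f g : ℝ → ℝ≥0∞}

lemma measurable_upStep [IsSFiniteKernel K] (hs : MeasurableSet s) (hf : Measurable f) :
    Measurable (upStep K s f) := by
  have hE : MeasurableSet {p : ℝ × ℝ | p.1 ≤ p.2 ∧ p.2 ∈ s} :=
    (measurableSet_le measurable_fst measurable_snd).inter (measurable_snd hs)
  have h : Measurable fun x => ∫⁻ y, {p : ℝ × ℝ | p.1 ≤ p.2 ∧ p.2 ∈ s}.indicator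
      (fun p => f p.2) (x, y) ∂(K x) :=
    ((hf.comp measurable_snd).indicator hE).lintegral_kernel_prod_right'
  convert h using 2 with x
  rw [upStep, ← lintegral_indicator (measurableSet_Ici.inter hs)]
  rfl

lemma measurable_iterate_upStep [IsSFiniteKernel K] (hs : MeasurableSet s) (hf : Measurable f)
    (n : ℕ) : Measurable ((upStep K s)^[n] f) := by
  induction n with
  | zero => exact hf
  | succ n ih => rw [Function.iterate_succ_apply']; exact measurable_upStep hs ih

lemma upStep_mono {x : ℝ} (hs : MeasurableSet s) (h : ∀ y ∈ s, x ≤ y → f y ≤ g y) :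
    upStep K s f x ≤ upStep K s g x :=
  setLIntegral_mono' (measurableSet_Ici.inter hs) fun y hy => h y hy.2 hy.1

lemma upStep_univ (hs : MeasurableSet s) (f : ℝ → ℝ≥0∞) (x : ℝ) :
    upStep K univ f x = upStep K s f x + upStep K sᶜ f x := by
  rw [upStep, upStep, upStep, ← lintegral_inter_add_sdiff f (Ici x ∩ univ) hs]
  simp [Set.sdiff_eq]

lemma tendsto_upStep {F : ℕ → ℝ → ℝ≥0∞} {b : ℝ → ℝ≥0∞} {x : ℝ} (hs : MeasurableSet s)
    (hF : ∀ n, Measurable (F n)) (hle : ∀ n, ∀ y ∈ s, x ≤ y → F n y ≤ b y)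
    (hb : upStep K s b x ≠ ∞) (hlim : ∀ y ∈ s, x ≤ y → Tendsto (fun n => F n y) atTop (𝓝 0)) :
    Tendsto (fun n => upStep K s (F n) x) atTop (𝓝 0) := by
  have hm : MeasurableSet (Ici x ∩ s) := measurableSet_Ici.inter hs
  have := tendsto_lintegral_of_dominated_convergence (μ := (K x).restrict (Ici x ∩ s))
    (F := F) (f := 0) b hF
    (fun n => (ae_restrict_mem hm).mono fun y hy => hle n y hy.2 hy.1) hb
    ((ae_restrict_mem hm).mono fun y hy => hlim y hy.2 hy.1)
  simpa [upStep] using this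

end upStep

/-- The positive part `(y - N)⁺`, valued in `ℝ≥0∞`. -/
noncomputable def excess (N : ℕ) (y : ℝ) : ℝ≥0∞ := ENNReal.ofReal (y - N)

/-- The supremum over `n` of the expected excess above `N` after `n` non-decreasing steps. -/
noncomputable def supExcess (K : Kernel ℝ ℝ) (N : ℕ) (x : ℝ) : ℝ≥0∞ :=
  ⨆ n, (upStep K univ)^[n] (excess N) x

lemma measurable_excess (N : ℕ) : Measurable (excess N) := by
  unfold excess; fun_prop

lemma excess_le (N : ℕ) (y : ℝ) : excess N y ≤ ENNReal.ofReal y :=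
  ENNReal.ofReal_le_ofReal (by simp)

lemma measurable_supExcess (K : Kernel ℝ ℝ) [IsSFiniteKernel K] (N : ℕ) :
    Measurable (supExcess K N) :=
  Measurable.iSup fun n => measurable_iterate_upStep .univ (measurable_excess N) n

lemma supExcess_le {K : Kernel ℝ ℝ}
    (hK : ∀ x, 0 < x → ∫⁻ y, ENNReal.ofReal y ∂(K x) = ENNReal.ofReal x)
    (N : ℕ) {x : ℝ} (hx : 0 < x) : supExcess K N x ≤ ENNReal.ofReal x := by
  refine iSup_le fun n => ?_
  induction n generalizing x with
  | zero => exact excess_le N x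
  | succ n ih =>
    rw [Function.iterate_succ_apply']
    calc _ ≤ upStep K univ ENNReal.ofReal x :=
          upStep_mono .univ fun y _ hy => ih (hx.trans_le hy)
      _ ≤ _ := (setLIntegral_le_lintegral _ _).trans (hK x hx).le

/-- If the expected excess vanishes in the limit at all points above `c`, then it does so at all
positive points: below `c` the process is bounded. -/
lemma tendsto_supExcess {K : Kernel ℝ ℝ} [IsSFiniteKernel K]
    (hK : ∀ x, 0 < x → ∫⁻ y, ENNReal.ofReal y ∂(K x) = ENNReal.ofReal x)
    {c : ℝ} (h : ∀ x, c ≤ x → Tendsto (fun N => supExcess K N x) atTop (𝓝 0))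
    {x : ℝ} (hx : 0 < x) : Tendsto (fun N => supExcess K N x) atTop (𝓝 0) := by
  set Q := upStep K (Iio c)
  set T := upStep K (Ici c)
  have hQT : ∀ f x, upStep K univ f x = Q f x + T f x := fun f x => by
    rw [upStep_univ measurableSet_Iio, compl_Iio]
  have hid : ∀ x, 0 < x → Q ENNReal.ofReal x + T ENNReal.ofReal x ≤ ENNReal.ofReal x :=
    fun x hx => by
      rw [← hQT]; exact (setLIntegral_le_lintegral _ _).trans (hK x hx).le
  have hQsum : ∀ (F : ℕ → ℝ → ℝ≥0∞) (_ : ∀ m, Measurable (F m)) (n : ℕ) (x : ℝ),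
      Q (fun y => ∑ m ∈ Finset.range n, F m y) x = ∑ m ∈ Finset.range n, Q (F m) x :=
    fun F hF n x => lintegral_finsetSum _ fun m _ => hF m
  have hmeas : ∀ f, Measurable f → ∀ m, Measurable (Q^[m] (T f)) := fun f hf m =>
    measurable_iterate_upStep measurableSet_Iio (measurable_upStep measurableSet_Ici hf) m
  have hsucc : ∀ f, Measurable f → ∀ n x, ∑ m ∈ Finset.range (n + 1), Q^[m] (T f) x
      = Q (fun y => ∑ m ∈ Finset.range n, Q^[m] (T f) y) x + T f x := fun f hf n x => by
    rw [Finset.sum_range_succ', hQsum _ (hmeas f hf)]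
    simp only [Function.iterate_succ_apply', Function.iterate_zero, id]
  have hdom : ∀ n x, 0 < x →
      ∑ m ∈ Finset.range n, Q^[m] (T ENNReal.ofReal) x ≤ ENNReal.ofReal x := by
    intro n
    induction n with
    | zero => simp
    | succ n ih =>
      intro x hx
      rw [hsucc _ ENNReal.measurable_ofReal]
      refine le_trans ?_ (hid x hx)
      gcongr
      exact upStep_mono measurableSet_Iio fun y _ hy => ih y (hx.trans_le hy)
  have hbound : ∀ N : ℕ, c ≤ N → ∀ n x, x < c → (upStep K univ)^[n] (excess N) x
      ≤ ∑ m ∈ Finset.range n, Q^[m] (T (supExcess K N)) x := by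
    intro N hN n
    induction n with
    | zero =>
      intro x hx
      simp only [Function.iterate_zero, id, Finset.range_zero, Finset.sum_empty]
      exact (ENNReal.ofReal_of_nonpos (by linarith)).le
    | succ n ih =>
      intro x _
      rw [hsucc _ (measurable_supExcess K N), Function.iterate_succ_apply', hQT]
      refine add_le_add (upStep_mono measurableSet_Iio fun y hy _ => ih y hy)
        (upStep_mono measurableSet_Ici fun y _ _ => ?_)
      exact le_iSup (fun n => (upStep K univ)^[n] (excess N) y) n
  have hmono : ∀ N m x, 0 < x →
      Q^[m] (T (supExcess K N)) x ≤ Q^[m] (T ENNReal.ofReal) x := by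
    intro N m
    induction m with
    | zero =>
      intro x hx
      exact upStep_mono (K := K) (s := Ici c) measurableSet_Ici
        fun y _ hy => supExcess_le hK N (hx.trans_le hy)
    | succ m ih =>
      intro x hx
      simp only [Function.iterate_succ_apply']
      exact upStep_mono measurableSet_Iio fun y _ hy => ih y (hx.trans_le hy)
  have hfin : ∀ m x, 0 < x → Q^[m] (T ENNReal.ofReal) x ≠ ∞ := fun m x hx =>
    ((Finset.single_le_sum (f := fun m => Q^[m] (T ENNReal.ofReal) x) (fun _ _ => zero_le)
      (Finset.self_mem_range_succ m)).trans (hdom (m + 1) x hx)).trans_lt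
      ENNReal.ofReal_lt_top |>.ne
  have hterm : ∀ m x, 0 < x →
      Tendsto (fun N => Q^[m] (T (supExcess K N)) x) atTop (𝓝 0) := by
    intro m
    induction m with
    | zero =>
      intro x hx
      exact tendsto_upStep measurableSet_Ici (measurable_supExcess K)
        (fun N y _ hy => supExcess_le hK N (hx.trans_le hy)) (hfin 0 x hx) fun y hy _ => h y hy
    | succ m ih =>
      intro x hx
      simp only [Function.iterate_succ_apply']
      refine tendsto_upStep (b := Q^[m] (T ENNReal.ofReal)) measurableSet_Iio
        (fun N => hmeas _ (measurable_supExcess K N) m)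
        (fun N y _ hy => hmono N m y (hx.trans_le hy)) ?_ fun y _ hy => ih y (hx.trans_le hy)
      have := hfin (m + 1) x hx
      rwa [Function.iterate_succ_apply'] at this
  rcases le_or_gt c x with hcx | hcx
  · exact h x hcx
  have hsum : Tendsto (fun N => ∑' m, Q^[m] (T (supExcess K N)) x) atTop (𝓝 0) := by
    simp_rw [← lintegral_count]
    have := tendsto_lintegral_of_dominated_convergence (μ := Measure.count)
      (F := fun N m => Q^[m] (T (supExcess K N)) x) (f := fun _ : ℕ => 0)
      (fun m => Q^[m] (T ENNReal.ofReal) x) (fun _ => measurable_from_top)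
      (fun N => .of_forall fun m => hmono N m x hx)
      (by
        rw [lintegral_count]
        exact (ENNReal.tsum_le_of_sum_range_le fun n => hdom n x hx).trans_lt
          ENNReal.ofReal_lt_top |>.ne)
      (.of_forall fun m => hterm m x hx)
    simpa using this
  obtain ⟨N₀, hN₀⟩ := exists_nat_ge c
  refine tendsto_of_tendsto_of_tendsto_of_le_of_le' tendsto_const_nhds hsum
    (.of_forall fun _ => zero_le) ?_
  filter_upwards [eventually_ge_atTop N₀] with N hN
  exact iSup_le fun n => (hbound N (hN₀.trans (by exact_mod_cast hN)) n x hcx).trans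
    (ENNReal.sum_le_tsum _)

section drawdownAfter

variable {Ω : Type*} {S : ℕ → Ω → ℝ} {j : ℕ} {ω : Ω}

lemma mem_monoEvent_add_succ {n : ℕ} : ω ∈ monoEvent S j (j + (n + 1)) ↔
    ω ∈ monoEvent S j (j + n) ∧ S (j + n) ω ≤ S (j + n + 1) ω := by
  refine ⟨fun h => ⟨fun i hi hin => h i hi (by omega), h _ (by omega) (by omega)⟩,
    fun h i hi hin => ?_⟩
  rcases (show i < j + n ∨ i = j + n by omega) with h' | rfl
  · exact h.1 i hi h'
  · exact h.2

lemma monoEvent_add_zero : monoEvent S j (j + 0) = univ :=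
  eq_univ_of_forall fun _ i hi hin => by omega

lemma drawdownAfter_eq_top_iff :
    drawdownAfter S j ω = ⊤ ↔ ω ∈ ⋂ n, monoEvent S j (j + n) := by
  rw [drawdownAfter, sInf_eq_top, mem_iInter]
  refine ⟨fun h n i hi _ => ?_, ?_⟩
  · by_contra! hlt
    exact ENat.natCast_ne_top _ (h ((i + 1 : ℕ) : ℕ∞)
      ⟨by exact_mod_cast Nat.lt_succ_of_le hi, i + 1, rfl, by simpa using hlt⟩)
  · rintro h _ ⟨hj, n, rfl, hn⟩
    have hj : j < n := by exact_mod_cast hj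
    have := h n (n - 1) (by omega) (by omega)
    rw [Nat.sub_add_cancel (by omega)] at this
    exact absurd hn this.not_gt

lemma drawdownAfter_eq_coe_iff {n : ℕ} : drawdownAfter S j ω = ((j + n + 1 : ℕ) : ℕ∞) ↔
    ω ∈ monoEvent S j (j + n) ∧ S (j + n + 1) ω < S (j + n) ω := by
  constructor
  · intro h
    have hne : {i : ℕ∞ | (j : ℕ∞) < i ∧ ∃ n : ℕ, i = (n : ℕ∞) ∧ S n ω < S (n - 1) ω}.Nonempty := by
      by_contra hne
      rw [not_nonempty_iff_eq_empty] at hne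
      rw [drawdownAfter, hne, sInf_empty] at h
      exact ENat.natCast_ne_top _ h.symm
    obtain ⟨_, m, hm, hlt⟩ := csInf_mem hne
    rw [← drawdownAfter, h, Nat.cast_inj] at hm
    subst hm
    refine ⟨fun i hi hin => ?_, by simpa using hlt⟩
    by_contra! hi'
    have : drawdownAfter S j ω ≤ ((i + 1 : ℕ) : ℕ∞) := sInf_le
      ⟨by exact_mod_cast Nat.lt_succ_of_le hi, i + 1, rfl, by simpa using hi'⟩
    rw [h, Nat.cast_le] at this
    omega
  · rintro ⟨h, hlt⟩
    refine le_antisymm (sInf_le ⟨by exact_mod_cast (by omega), _, rfl, by simpa using hlt⟩)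
      (le_sInf ?_)
    rintro _ ⟨hj, m, rfl, hm⟩
    have hj : j < m := by exact_mod_cast hj
    rw [Nat.cast_le]
    by_contra! hlt'
    have := h (m - 1) (by omega) (by omega)
    rw [Nat.sub_add_cancel (by omega)] at this
    exact absurd hm this.not_gt

lemma lt_drawdownAfter : (j : ℕ∞) < drawdownAfter S j ω := by
  refine lt_of_lt_of_le (b := ((j + 1 : ℕ) : ℕ∞)) (by exact_mod_cast Nat.lt_succ_self j)
    (le_sInf ?_)
  rintro _ ⟨hj, m, rfl, -⟩
  exact_mod_cast Order.add_one_le_of_lt (by exact_mod_cast hj : j < m)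

lemma drawdown_succ_of_eq {k : ℕ} (h : drawdown S k ω = j) :
    drawdown S (k + 1) ω = drawdownAfter S j ω := by
  simp only [drawdown, h, drawdownAfter]

lemma drawdown_succ_of_eq_top {k : ℕ} (h : drawdown S k ω = ⊤) : drawdown S (k + 1) ω = ⊤ := by
  simp [drawdown, h]

end drawdownAfter

section markov

variable {Ω : Type*} [MeasurableSpace Ω] (M : MarkovMartingale Ω) {x : ℝ}

lemma lintegral_kernel (hx : 0 < x) :
    ∫⁻ y, ENNReal.ofReal y ∂(M.K x) = ENNReal.ofReal x := by
  have h0 : ∀ᵐ y ∂(M.K x), 0 ≤ y :=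
    measure_mono_null (fun y (hy : ¬ 0 ≤ y) => (not_le.1 hy).le) (M.kernel_pos x hx)
  have := ofReal_integral_eq_lintegral_ofReal (M.kernel_int x hx) h0
  simp only [id] at this
  rw [← this, M.kernel_mart x hx]

lemma measurable_S (n : ℕ) : Measurable[M.F n] (M.S n) :=
  ((M.mart 1 one_pos).1 n).measurable

lemma measurable_S' (n : ℕ) : Measurable (M.S n) := (M.measurable_S n).mono (M.F.le n) le_rfl

lemma measurable_S_of_le {m n : ℕ} (h : m ≤ n) : Measurable[M.F n] (M.S m) :=
  (M.measurable_S m).mono (M.F.mono h) le_rfl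

lemma measurableSet_monoEvent (j n : ℕ) : MeasurableSet[M.F n] (monoEvent M.S j n) := by
  have : monoEvent M.S j n
      = ⋂ (i : ℕ) (_ : j ≤ i) (_ : i < n), {ω | M.S i ω ≤ M.S (i + 1) ω} := by
    ext; simp [monoEvent]
  rw [this]
  exact MeasurableSet.iInter fun i => MeasurableSet.iInter fun _ => MeasurableSet.iInter fun hi =>
    @measurableSet_le _ _ _ _ _ (M.F n) _ _ _ _ _ (M.measurable_S_of_le hi.le) (M.measurable_S_of_le hi)

lemma setLIntegral_step (hx : 0 < x) {n : ℕ} {B : Set Ω} (hB : MeasurableSet[M.F n] B)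
    {f : ℝ × ℝ → ℝ≥0∞} (hf : Measurable f) :
    ∫⁻ ω in B, f (M.S n ω, M.S (n + 1) ω) ∂(M.P x)
      = ∫⁻ ω in B, ∫⁻ y, f (M.S n ω, y) ∂(M.K (M.S n ω)) ∂(M.P x) := by
  have := M.prob x hx
  have := M.markov
  have hS := M.measurable_S' n
  have hS1 := M.measurable_S' (n + 1)
  have key : ((M.P x).restrict B).map (fun ω => (M.S n ω, M.S (n + 1) ω))
      = (((M.P x).restrict B).map (M.S n)) ⊗ₘ M.K := by
    refine Measure.ext_prod fun {s t} hs ht => ?_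
    rw [Measure.map_apply (hS.prodMk hS1) (hs.prod ht), Measure.compProd_apply_prod hs ht,
      setLIntegral_map hs (M.K.measurable_coe ht) hS, mk_preimage_prod,
      Measure.restrict_restrict (hS hs), Measure.restrict_apply ((hS hs).inter (hS1 ht))]
    have hC : MeasurableSet[M.F n] (M.S n ⁻¹' s ∩ B) := (M.measurable_S n hs).inter hB
    have hstep := M.step x hx n (t.indicator 1) (measurable_one.indicator ht)
      ⟨1, fun y => by by_cases hy : y ∈ t <;> simp [hy]⟩
    have hE : Integrable (fun ω => t.indicator (1 : ℝ → ℝ) (M.S (n + 1) ω)) (M.P x) :=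
      (integrable_const (1 : ℝ)).indicator (hS1 ht)
    have h1 := setIntegral_condExp (M.F.le n) hE hC
    rw [setIntegral_congr_ae (M.F.le n _ hC) (hstep.mono fun ω h _ => h)] at h1
    have h2 : ∀ ω, ∫ y, t.indicator (1 : ℝ → ℝ) y ∂(M.K (M.S n ω))
        = (M.K (M.S n ω) t).toReal := fun ω => integral_indicator_one ht
    have h3 : ∫ ω in M.S n ⁻¹' s ∩ B, t.indicator (1 : ℝ → ℝ) (M.S (n + 1) ω) ∂(M.P x)
        = (M.P x (M.S n ⁻¹' s ∩ M.S (n + 1) ⁻¹' t ∩ B)).toReal := by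
      have := integral_indicator_one (μ := (M.P x).restrict (M.S n ⁻¹' s ∩ B)) (hS1 ht)
      rw [measureReal_restrict_apply (hS1 ht)] at this
      rw [inter_comm (M.S (n + 1) ⁻¹' t), inter_right_comm] at this
      exact this
    simp only [h2] at h1
    rw [h3, integral_toReal (f := fun ω => M.K (M.S n ω) t) ((M.K.measurable_coe ht).comp hS).aemeasurable
      (.of_forall fun ω => measure_lt_top _ _)] at h1
    refine ((ENNReal.toReal_eq_toReal_iff' ?_ (measure_ne_top _ _)).1 h1).symm
    refine ne_top_of_le_ne_top (measure_ne_top ((M.P x).restrict (M.S n ⁻¹' s ∩ B)) univ) ?_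
    rw [← lintegral_one]
    exact lintegral_mono fun ω => prob_le_one
  rw [← lintegral_map (f := f) hf (hS.prodMk hS1), key, Measure.lintegral_compProd hf,
    lintegral_map hf.lintegral_kernel_prod_right' hS]

lemma setLIntegral_monoEvent (hx : 0 < x) {j : ℕ} {B : Set Ω} (hB : MeasurableSet[M.F j] B)
    (n : ℕ) {φ : ℝ → ℝ≥0∞} (hφ : Measurable φ) :
    ∫⁻ ω in B ∩ monoEvent M.S j (j + n), φ (M.S (j + n) ω) ∂(M.P x)
      = ∫⁻ ω in B, (upStep M.K univ)^[n] φ (M.S j ω) ∂(M.P x) := by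
  have := M.markov
  induction n generalizing φ with
  | zero => rw [monoEvent_add_zero, inter_univ]; rfl
  | succ n ih =>
    have hC : MeasurableSet[M.F (j + n)] (B ∩ monoEvent M.S j (j + n)) :=
      (M.F.mono (Nat.le_add_right j n) _ hB).inter (M.measurableSet_monoEvent j _)
    have hD : MeasurableSet {ω | M.S (j + n) ω ≤ M.S (j + n + 1) ω} :=
      measurableSet_le (M.measurable_S' _) (M.measurable_S' _)
    have hset : B ∩ monoEvent M.S j (j + (n + 1))
        = {ω | M.S (j + n) ω ≤ M.S (j + n + 1) ω} ∩ (B ∩ monoEvent M.S j (j + n)) := by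
      ext ω
      simp only [mem_inter_iff, mem_monoEvent_add_succ, mem_ofPred_eq]
      tauto
    have hE : MeasurableSet {p : ℝ × ℝ | p.1 ≤ p.2} :=
      measurableSet_le measurable_fst measurable_snd
    rw [Function.iterate_succ_apply, ← ih (measurable_upStep .univ hφ), hset,
      ← Measure.restrict_restrict hD, ← lintegral_indicator hD]
    have := M.setLIntegral_step hx hC ((hφ.comp measurable_snd).indicator hE)
    refine Eq.trans ?_ (this.trans ?_)
    · rfl
    · refine lintegral_congr fun ω => ?_
      rw [upStep, inter_univ, ← lintegral_indicator measurableSet_Ici]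
      rfl

/-- The event that the first drawdown after time `j` takes place at time `j + i + 1`. -/
def dropEvent (j i : ℕ) : Set Ω :=
  monoEvent M.S j (j + i) ∩ {ω | M.S (j + i + 1) ω < M.S (j + i) ω}

/-- The event that there is no drawdown after time `j`. -/
def noDropEvent (j : ℕ) : Set Ω := ⋂ n, monoEvent M.S j (j + n)

lemma measurableSet_dropEvent (j i : ℕ) : MeasurableSet[M.F (j + i + 1)] (M.dropEvent j i) :=
  (M.F.mono (Nat.le_succ _) _ (M.measurableSet_monoEvent j _)).inter
    (@measurableSet_lt _ _ _ _ _ (M.F (j + i + 1)) _ _ _ _ _ (M.measurable_S _)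
      (M.measurable_S_of_le (Nat.le_succ _)))

lemma measurableSet_noDropEvent (j : ℕ) : MeasurableSet (M.noDropEvent j) :=
  MeasurableSet.iInter fun _ => M.F.le _ _ (M.measurableSet_monoEvent j _)

lemma mem_dropEvent_iff {j i : ℕ} {ω : Ω} :
    ω ∈ M.dropEvent j i ↔ drawdownAfter M.S j ω = ((j + i + 1 : ℕ) : ℕ∞) :=
  drawdownAfter_eq_coe_iff.symm

lemma mem_noDropEvent_iff {j : ℕ} {ω : Ω} :
    ω ∈ M.noDropEvent j ↔ drawdownAfter M.S j ω = ⊤ :=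
  drawdownAfter_eq_top_iff.symm

lemma disjoint_dropEvent (j : ℕ) : Pairwise (Function.onFun Disjoint (M.dropEvent j)) := by
  refine fun i i' hne => disjoint_left.2 fun ω h h' => hne ?_
  rw [mem_dropEvent_iff] at h h'
  rw [h, Nat.cast_inj] at h'
  omega

lemma iUnion_dropEvent_union_noDropEvent (j : ℕ) :
    (⋃ i, M.dropEvent j i) ∪ M.noDropEvent j = univ := by
  refine eq_univ_of_forall fun ω => ?_
  rw [mem_union, mem_iUnion, mem_noDropEvent_iff]
  rcases h : drawdownAfter M.S j ω with _ | n
  · exact Or.inr rfl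
  · have hlt := lt_drawdownAfter (S := M.S) (j := j) (ω := ω)
    rw [h] at hlt
    have hlt : j < n := ENat.natCast_lt_natCast.1 hlt
    refine Or.inl ⟨n - j - 1, M.mem_dropEvent_iff.2 ?_⟩
    rw [h, show j + (n - j - 1) + 1 = n by omega]
    rfl

lemma disjoint_iUnion_dropEvent (j : ℕ) :
    Disjoint (⋃ i, M.dropEvent j i) (M.noDropEvent j) := by
  refine disjoint_left.2 fun ω h h' => ?_
  obtain ⟨i, hi⟩ := mem_iUnion.1 h
  rw [mem_dropEvent_iff] at hi
  rw [mem_noDropEvent_iff, hi] at h'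
  exact ENat.natCast_ne_top _ h'

lemma setLIntegral_evalAt_drawdownAfter (j : ℕ) {B : Set Ω} (hB : MeasurableSet B) :
    ∫⁻ ω in B, ENNReal.ofReal (evalAt M.S M.Sinf (drawdownAfter M.S j) ω) ∂(M.P x)
      = ∑' i, ∫⁻ ω in B ∩ M.dropEvent j i, ENNReal.ofReal (M.S (j + i + 1) ω) ∂(M.P x)
        + ∫⁻ ω in B ∩ M.noDropEvent j, ENNReal.ofReal (M.Sinf ω) ∂(M.P x) := by
  have hdrop : ∀ i, MeasurableSet (B ∩ M.dropEvent j i) := fun i =>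
    hB.inter (M.F.le _ _ (M.measurableSet_dropEvent j i))
  have hno : MeasurableSet (B ∩ M.noDropEvent j) := hB.inter (M.measurableSet_noDropEvent j)
  conv_lhs => rw [← inter_univ B, ← M.iUnion_dropEvent_union_noDropEvent j, inter_union_distrib_left,
    inter_iUnion]
  rw [lintegral_union hno, lintegral_iUnion hdrop]
  · congr 1
    · refine tsum_congr fun i => setLIntegral_congr_fun (hdrop i) fun ω hω => ?_
      have := M.mem_dropEvent_iff.1 hω.2
      simp only [evalAt, this, ENat.natCast_ne_top, if_false, ENat.toNat_natCast]
    · refine setLIntegral_congr_fun hno fun ω hω => ?_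
      have := M.mem_noDropEvent_iff.1 hω.2
      simp only [evalAt, this, if_true]
  · exact fun i i' hne => (M.disjoint_dropEvent j hne).mono inter_subset_right inter_subset_right
  · rw [← inter_iUnion]
    exact (M.disjoint_iUnion_dropEvent j).mono inter_subset_right inter_subset_right

lemma setLIntegral_eq_sum_add (hx : 0 < x) {j : ℕ} {B : Set Ω} (hB : MeasurableSet[M.F j] B)
    (n : ℕ) : ∫⁻ ω in B, ENNReal.ofReal (M.S j ω) ∂(M.P x)
      = ∑ i ∈ Finset.range n,
          ∫⁻ ω in B ∩ M.dropEvent j i, ENNReal.ofReal (M.S (j + i + 1) ω) ∂(M.P x)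
        + ∫⁻ ω in B ∩ monoEvent M.S j (j + n), ENNReal.ofReal (M.S (j + n) ω) ∂(M.P x) := by
  induction n with
  | zero => rw [monoEvent_add_zero, inter_univ, Finset.range_zero, Finset.sum_empty, zero_add]; rfl
  | succ n ih =>
    have hC : MeasurableSet[M.F (j + n)] (B ∩ monoEvent M.S j (j + n)) :=
      (M.F.mono (Nat.le_add_right j n) _ hB).inter (M.measurableSet_monoEvent j _)
    have hstep := M.setLIntegral_step hx hC (f := fun p => ENNReal.ofReal p.2) (by fun_prop)
    have hker : ∫⁻ ω in B ∩ monoEvent M.S j (j + n),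
        ∫⁻ y, ENNReal.ofReal y ∂(M.K (M.S (j + n) ω)) ∂(M.P x)
        = ∫⁻ ω in B ∩ monoEvent M.S j (j + n), ENNReal.ofReal (M.S (j + n) ω) ∂(M.P x) :=
      setLIntegral_congr_fun_ae (M.F.le _ _ hC)
        ((M.pos x hx).mono fun ω hω _ => M.lintegral_kernel (hω _))
    have hD : MeasurableSet {ω | M.S (j + n + 1) ω < M.S (j + n) ω} :=
      measurableSet_lt (M.measurable_S' _) (M.measurable_S' _)
    have hset : (B ∩ monoEvent M.S j (j + n)) \ {ω | M.S (j + n + 1) ω < M.S (j + n) ω}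
        = B ∩ monoEvent M.S j (j + (n + 1)) := by
      ext ω
      simp only [Set.mem_sdiff, mem_inter_iff, mem_ofPred_eq, not_lt, mem_monoEvent_add_succ]
      tauto
    rw [ih, ← hker, ← hstep, Finset.sum_range_succ, add_assoc (∑ _ ∈ _, _),
      ← lintegral_inter_add_sdiff _ _ hD, hset, inter_assoc]
    rfl

lemma tendsto_setLIntegral_noDropEvent (hx : 0 < x) (j : ℕ) {B : Set Ω} (hB : MeasurableSet B) :
    Tendsto (fun n => ∫⁻ ω in B ∩ M.noDropEvent j, ENNReal.ofReal (M.S (j + n) ω) ∂(M.P x))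
      atTop (𝓝 (∫⁻ ω in B ∩ M.noDropEvent j, ENNReal.ofReal (M.Sinf ω) ∂(M.P x))) := by
  refine lintegral_tendsto_of_tendsto_of_monotone
    (fun n => (M.measurable_S' _).ennreal_ofReal.aemeasurable) ?_ ?_
  · filter_upwards [ae_restrict_mem (hB.inter (M.measurableSet_noDropEvent j))] with ω hω
    refine monotone_nat_of_le_succ fun n => ENNReal.ofReal_le_ofReal ?_
    exact mem_iInter.1 hω.2 (n + 1) (j + n) (by omega) (by omega)
  · filter_upwards [ae_restrict_of_ae (M.conv x hx)] with ω hω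
    refine (ENNReal.continuous_ofReal.tendsto _).comp (hω.comp ?_)
    exact tendsto_atTop_mono (fun n => Nat.le_add_left n j) tendsto_id

lemma lintegral_S_ne_top (hx : 0 < x) (j : ℕ) :
    ∫⁻ ω, ENNReal.ofReal (M.S j ω) ∂(M.P x) ≠ ∞ :=
  ((M.mart x hx).integrable j).lintegral_lt_top.ne

/-- No mass is gained at the first drawdown. -/
lemma setLIntegral_evalAt_drawdownAfter_le (hx : 0 < x) {j : ℕ} {B : Set Ω}
    (hB : MeasurableSet[M.F j] B) :
    ∫⁻ ω in B, ENNReal.ofReal (evalAt M.S M.Sinf (drawdownAfter M.S j) ω) ∂(M.P x)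
      ≤ ∫⁻ ω in B, ENNReal.ofReal (M.S j ω) ∂(M.P x) := by
  have hB' := M.F.le _ _ hB
  rw [M.setLIntegral_evalAt_drawdownAfter j hB']
  refine le_of_tendsto ((ENNReal.summable.hasSum.tendsto_sum_nat).add
    (M.tendsto_setLIntegral_noDropEvent hx j hB')) (.of_forall fun n => ?_)
  rw [M.setLIntegral_eq_sum_add hx hB n]
  gcongr
  exact iInter_subset _ n

lemma tendsto_monoEvent_min (hx : 0 < x) {j : ℕ} {B : Set Ω} (hB : MeasurableSet B) (N : ℕ) :
    Tendsto (fun n => ∫⁻ ω in B ∩ monoEvent M.S j (j + n), min (ENNReal.ofReal (M.S (j + n) ω)) N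
        ∂(M.P x)) atTop
      (𝓝 (∫⁻ ω in B ∩ M.noDropEvent j, min (ENNReal.ofReal (M.Sinf ω)) N ∂(M.P x))) := by
  have := M.prob x hx
  have hm : ∀ n, MeasurableSet (B ∩ monoEvent M.S j (j + n)) := fun n =>
    hB.inter (M.F.le _ _ (M.measurableSet_monoEvent j _))
  have hm' := hB.inter (M.measurableSet_noDropEvent j)
  simp_rw [← lintegral_indicator (hm _)]
  rw [← lintegral_indicator hm']
  refine tendsto_lintegral_of_dominated_convergence (fun _ => (N : ℝ≥0∞)) (fun n => ?_)
    (fun n => .of_forall fun ω => ?_) (by simp) ?_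
  · exact ((M.measurable_S' _).ennreal_ofReal.min measurable_const).indicator (hm n)
  · exact (indicator_le_self _ _ _).trans (min_le_right _ _)
  · filter_upwards [M.conv x hx] with ω hω
    by_cases hmem : ω ∈ B ∩ M.noDropEvent j
    · have : ∀ n, ω ∈ B ∩ monoEvent M.S j (j + n) := fun n => ⟨hmem.1, mem_iInter.1 hmem.2 n⟩
      simp only [indicator_of_mem hmem, indicator_of_mem (this _)]
      refine Tendsto.min ((ENNReal.continuous_ofReal.tendsto _).comp (hω.comp ?_))
        tendsto_const_nhds
      exact tendsto_atTop_mono (fun n => Nat.le_add_left n j) tendsto_id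
    · rw [indicator_of_notMem hmem]
      refine tendsto_const_nhds.congr' ?_
      obtain ⟨m, hm⟩ : ∃ m, ω ∉ B ∩ monoEvent M.S j (j + m) := by
        by_contra! h
        exact hmem ⟨(h 0).1, mem_iInter.2 fun n => (h n).2⟩
      filter_upwards [eventually_ge_atTop m] with n hn
      rw [indicator_of_notMem]
      exact fun h => hm ⟨h.1, fun i hi hin => h.2 i hi (by omega)⟩

/-- If the expected excess vanishes in the limit from all positive starting points, then no mass
is lost at the first drawdown after any deterministic time. -/
lemma setLIntegral_evalAt_drawdownAfter_eq (hx : 0 < x)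
    (h : ∀ y, 0 < y → Tendsto (fun N => supExcess M.K N y) atTop (𝓝 0))
    {j : ℕ} {B : Set Ω} (hB : MeasurableSet[M.F j] B) :
    ∫⁻ ω in B, ENNReal.ofReal (evalAt M.S M.Sinf (drawdownAfter M.S j) ω) ∂(M.P x)
      = ∫⁻ ω in B, ENNReal.ofReal (M.S j ω) ∂(M.P x) := by
  have := M.markov
  have hB' := M.F.le _ _ hB
  refine le_antisymm (M.setLIntegral_evalAt_drawdownAfter_le hx hB) ?_
  rw [M.setLIntegral_evalAt_drawdownAfter j hB']
  set D := ∑' i, ∫⁻ ω in B ∩ M.dropEvent j i, ENNReal.ofReal (M.S (j + i + 1) ω) ∂(M.P x)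
  set E := ∫⁻ ω in B ∩ M.noDropEvent j, ENNReal.ofReal (M.Sinf ω) ∂(M.P x)
  have hU : Tendsto (fun N => ∫⁻ ω in B, supExcess M.K N (M.S j ω) ∂(M.P x)) atTop (𝓝 0) := by
    have := tendsto_lintegral_of_dominated_convergence (μ := (M.P x).restrict B)
      (F := fun N ω => supExcess M.K N (M.S j ω)) (f := 0)
      (fun ω => ENNReal.ofReal (M.S j ω))
      (fun N => (measurable_supExcess M.K N).comp (M.measurable_S' j))
      (fun N => ae_restrict_of_ae ((M.pos x hx).mono fun ω hω =>
        supExcess_le (fun _ => M.lintegral_kernel) N (hω j)))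
      (ne_top_of_le_ne_top (M.lintegral_S_ne_top hx j) (setLIntegral_le_lintegral _ _))
      (ae_restrict_of_ae ((M.pos x hx).mono fun ω hω => h _ (hω j)))
    simpa using this
  have hN : ∀ N : ℕ, ∫⁻ ω in B, ENNReal.ofReal (M.S j ω) ∂(M.P x)
      ≤ D + (E + ∫⁻ ω in B, supExcess M.K N (M.S j ω) ∂(M.P x)) := by
    intro N
    have hlim := ((M.tendsto_monoEvent_min (j := j) hx hB' N).add_const
      (∫⁻ ω in B, supExcess M.K N (M.S j ω) ∂(M.P x))).const_add D
    refine (ge_of_tendsto hlim (.of_forall fun n => ?_)).trans ?_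
    · rw [M.setLIntegral_eq_sum_add hx hB n]
      refine add_le_add (ENNReal.sum_le_tsum _) ?_
      calc ∫⁻ ω in B ∩ monoEvent M.S j (j + n), ENNReal.ofReal (M.S (j + n) ω) ∂(M.P x)
          ≤ ∫⁻ ω in B ∩ monoEvent M.S j (j + n), (min (ENNReal.ofReal (M.S (j + n) ω)) N
              + excess N (M.S (j + n) ω)) ∂(M.P x) := by
            refine lintegral_mono fun ω => ?_
            rcases le_total (M.S (j + n) ω) N with hle | hle
            · refine le_add_right (le_min le_rfl ?_)
              exact (ENNReal.ofReal_le_ofReal hle).trans (ENNReal.ofReal_natCast N).le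
            · rw [min_eq_right, excess, ← ENNReal.ofReal_natCast,
                ← ENNReal.ofReal_add (Nat.cast_nonneg N) (sub_nonneg.2 hle), add_sub_cancel]
              exact (ENNReal.ofReal_natCast N).ge.trans (ENNReal.ofReal_le_ofReal hle)
        _ = _ + ∫⁻ ω in B, (upStep M.K univ)^[n] (excess N) (M.S j ω) ∂(M.P x) := by
            rw [lintegral_add_right (g := fun ω => excess N (M.S (j + n) ω)) _
                ((measurable_excess N).comp (M.measurable_S' _)),
              M.setLIntegral_monoEvent hx hB n (measurable_excess N)]
        _ ≤ _ := by
            gcongr with ω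
            exact le_iSup (fun n => (upStep M.K univ)^[n] (excess N) (M.S j ω)) n
    · gcongr
      exact lintegral_mono fun ω => min_le_left _ _
  have hlim := (hU.const_add E).const_add D
  rw [add_zero] at hlim
  exact ge_of_tendsto' hlim hN

lemma tendsto_excess (y : ℝ) : Tendsto (fun N => excess N y) atTop (𝓝 0) := by
  obtain ⟨m, hm⟩ := exists_nat_ge y
  refine tendsto_const_nhds.congr' ?_
  filter_upwards [eventually_ge_atTop m] with N hN
  have : (m : ℝ) ≤ N := by exact_mod_cast hN
  exact (ENNReal.ofReal_of_nonpos (by linarith)).symm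

lemma aemeasurable_Sinf (hx : 0 < x) : AEMeasurable M.Sinf (M.P x) :=
  aemeasurable_of_tendsto_metrizable_ae atTop (fun n => (M.measurable_S' n).aemeasurable)
    (M.conv x hx)

lemma aemeasurable_evalAt (hx : 0 < x) {τ : Ω → ℕ∞} (hτ : ∀ t, MeasurableSet {ω | τ ω = t}) :
    AEMeasurable (evalAt M.S M.Sinf τ) (M.P x) := by
  have huniv : ⋃ t, {ω | τ ω = t} = univ := eq_univ_of_forall fun ω => mem_iUnion.2 ⟨τ ω, rfl⟩
  rw [← Measure.restrict_univ (μ := M.P x), ← huniv, aemeasurable_iUnion_iff]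
  intro t
  by_cases ht : t = ⊤
  · refine (M.aemeasurable_Sinf hx).restrict.congr ?_
    filter_upwards [ae_restrict_mem (hτ t)] with ω hω
    have hω : τ ω = ⊤ := Eq.trans hω ht
    simp only [evalAt, hω, if_true]
  · refine (M.measurable_S' t.toNat).aemeasurable.congr ?_
    filter_upwards [ae_restrict_mem (hτ t)] with ω hω
    have hω : τ ω = t := hω
    simp only [evalAt, hω, ht, if_false]

lemma evalAt_nonneg (hx : 0 < x) (τ : Ω → ℕ∞) : 0 ≤ᵐ[M.P x] evalAt M.S M.Sinf τ := by
  filter_upwards [M.pos x hx, M.conv x hx] with ω hpos hconv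
  simp only [evalAt, Pi.zero_apply]
  split_ifs
  · exact ge_of_tendsto' hconv fun n => (hpos n).le
  · exact (hpos _).le

lemma integral_evalAt (hx : 0 < x) {τ : Ω → ℕ∞} (hτ : ∀ t, MeasurableSet {ω | τ ω = t}) :
    ∫ ω, evalAt M.S M.Sinf τ ω ∂(M.P x)
      = (∫⁻ ω, ENNReal.ofReal (evalAt M.S M.Sinf τ ω) ∂(M.P x)).toReal :=
  integral_eq_lintegral_of_nonneg_ae (M.evalAt_nonneg hx τ)
    (M.aemeasurable_evalAt hx hτ).aestronglyMeasurable

lemma measurableSet_drawdown_eq_coe (k j : ℕ) :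
    MeasurableSet[M.F j] {ω | drawdown M.S k ω = (j : ℕ∞)} := by
  induction k generalizing j with
  | zero => exact @MeasurableSet.const Ω (M.F j) ((0 : ℕ∞) = j)
  | succ k ih =>
    have : {ω | drawdown M.S (k + 1) ω = (j : ℕ∞)}
        = ⋃ (i : ℕ) (m : ℕ) (_ : i + m + 1 = j),
          {ω | drawdown M.S k ω = (i : ℕ∞)} ∩ M.dropEvent i m := by
      ext ω
      simp only [mem_iUnion, mem_inter_iff, mem_ofPred_eq, mem_dropEvent_iff, exists_prop]
      constructor
      · intro h
        rcases hk : drawdown M.S k ω with _ | i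
        · rw [drawdown_succ_of_eq_top hk] at h
          exact absurd h.symm (ENat.natCast_ne_top j)
        · rw [drawdown_succ_of_eq (j := i) hk] at h
          have hlt := lt_drawdownAfter (S := M.S) (j := i) (ω := ω)
          rw [h, ENat.natCast_lt_natCast] at hlt
          have hj : i + (j - i - 1) + 1 = j := by omega
          exact ⟨i, j - i - 1, hj, rfl, by rw [h, hj]⟩
      · rintro ⟨i, m, rfl, hi, hm⟩
        rw [drawdown_succ_of_eq hi, hm]
    rw [this]
    refine MeasurableSet.iUnion fun i => MeasurableSet.iUnion fun m => MeasurableSet.iUnion ?_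
    rintro rfl
    exact (M.F.mono (by omega) _ (ih i)).inter (M.measurableSet_dropEvent i m)

lemma measurableSet_drawdown_eq (k : ℕ) (t : ℕ∞) : MeasurableSet {ω | drawdown M.S k ω = t} := by
  cases t with
  | coe j => exact M.F.le _ _ (M.measurableSet_drawdown_eq_coe k j)
  | top =>
    have : {ω | drawdown M.S k ω = ⊤} = (⋃ j : ℕ, {ω | drawdown M.S k ω = (j : ℕ∞)})ᶜ := by
      ext ω
      simp only [mem_compl_iff, mem_iUnion, mem_ofPred_eq]
      exact ⟨fun h ⟨j, hj⟩ => ENat.natCast_ne_top j (hj.symm.trans h), fun h => by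
        by_contra hne
        exact h ⟨_, (ENat.natCast_toNat hne).symm⟩⟩
    rw [this]
    exact (MeasurableSet.iUnion fun j => M.F.le _ _ (M.measurableSet_drawdown_eq_coe k j)).compl

lemma drawdown_one : drawdown M.S 1 = drawdownAfter M.S 0 :=
  funext fun _ => drawdown_succ_of_eq (k := 0) (j := 0) Nat.cast_zero.symm

lemma lintegral_S_zero (hx : 0 < x) (f : ℝ → ℝ≥0∞) : ∫⁻ ω, f (M.S 0 ω) ∂(M.P x) = f x := by
  have := M.prob x hx
  rw [lintegral_congr_ae ((M.start x hx).mono fun ω hω => by rw [hω]), lintegral_const,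
    measure_univ, mul_one]

/-- If no mass is lost at the first drawdown, then the process stopped there is uniformly
integrable. -/
lemma tendsto_supExcess_of_defaultFn_eq_zero (hx : 0 < x) (h : M.defaultFn x = 0) :
    Tendsto (fun N => supExcess M.K N x) atTop (𝓝 0) := by
  have hmass : ∫⁻ ω, ENNReal.ofReal (evalAt M.S M.Sinf (drawdownAfter M.S 0) ω) ∂(M.P x)
      = ENNReal.ofReal x := by
    rw [defaultFn, M.integral_evalAt hx (M.measurableSet_drawdown_eq 1), M.drawdown_one,
      sub_eq_zero] at h
    conv_rhs => rw [h]
    rw [ENNReal.ofReal_toReal]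
    intro htop
    rw [htop, ENNReal.toReal_top] at h
    exact hx.ne' h
  have hdec := M.setLIntegral_evalAt_drawdownAfter (x := x) 0 MeasurableSet.univ
  have hsum := fun n => M.setLIntegral_eq_sum_add hx (j := 0) MeasurableSet.univ n
  have hJ := M.tendsto_setLIntegral_noDropEvent hx 0 MeasurableSet.univ
  simp only [univ_inter, Measure.restrict_univ, M.lintegral_S_zero hx ENNReal.ofReal, zero_add,
    hmass] at hdec hsum hJ
  set D := ∑' i, ∫⁻ ω in M.dropEvent 0 i, ENNReal.ofReal (M.S (i + 1) ω) ∂(M.P x)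
  set E := ∫⁻ ω in M.noDropEvent 0, ENNReal.ofReal (M.Sinf ω) ∂(M.P x)
  have hE : E ≠ ∞ := ne_top_of_le_ne_top ENNReal.ofReal_ne_top (hdec ▸ le_add_self)
  have hD : D ≠ ∞ := ne_top_of_le_ne_top ENNReal.ofReal_ne_top (hdec ▸ le_self_add)
  have hA : MeasurableSet (M.noDropEvent 0) := M.measurableSet_noDropEvent 0
  have hsub : ∀ n, M.noDropEvent 0 ⊆ monoEvent M.S 0 n := fun n ω hω => by
    simpa using mem_iInter.1 hω n
  have hsplit : ∀ (f : Ω → ℝ≥0∞) n, ∫⁻ ω in monoEvent M.S 0 n, f ω ∂(M.P x)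
      = ∫⁻ ω in M.noDropEvent 0, f ω ∂(M.P x)
        + ∫⁻ ω in monoEvent M.S 0 n \ M.noDropEvent 0, f ω ∂(M.P x) := fun f n => by
    rw [← lintegral_inter_add_sdiff f _ hA, inter_eq_right.2 (hsub n)]
  have hH : Tendsto (fun n => ∫⁻ ω in monoEvent M.S 0 n, ENNReal.ofReal (M.S n ω) ∂(M.P x))
      atTop (𝓝 E) := by
    have hlim := ENNReal.Tendsto.sub (tendsto_const_nhds (x := ENNReal.ofReal x) (f := atTop))
      (ENNReal.summable.hasSum.tendsto_sum_nat : Tendsto _ atTop (𝓝 D))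
      (Or.inl ENNReal.ofReal_ne_top)
    rw [hdec, ENNReal.add_sub_cancel_left hD, ← hdec] at hlim
    refine hlim.congr fun n => ?_
    rw [hsum n, ENNReal.add_sub_cancel_left]
    exact ne_top_of_le_ne_top hD (ENNReal.sum_le_tsum _)
  have hδ : Tendsto (fun n => ∫⁻ ω in monoEvent M.S 0 n \ M.noDropEvent 0,
      ENNReal.ofReal (M.S n ω) ∂(M.P x)) atTop (𝓝 0) := by
    have hlim := ENNReal.Tendsto.sub hH hJ (Or.inl hE)
    rw [tsub_self] at hlim
    refine hlim.congr fun n => ?_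
    rw [hsplit, ENNReal.add_sub_cancel_left]
    exact ne_top_of_le_ne_top (M.lintegral_S_ne_top hx n) (setLIntegral_le_lintegral _ _)
  have he : Tendsto (fun N => ∫⁻ ω in M.noDropEvent 0, excess N (M.Sinf ω) ∂(M.P x)) atTop
      (𝓝 0) := by
    have := tendsto_lintegral_of_dominated_convergence' (μ := (M.P x).restrict (M.noDropEvent 0))
      (F := fun N ω => excess N (M.Sinf ω)) (f := 0) (fun ω => ENNReal.ofReal (M.Sinf ω))
      (fun N => (measurable_excess N).comp_aemeasurable (M.aemeasurable_Sinf hx).restrict)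
      (fun N => .of_forall fun ω => excess_le N _) hE
      (.of_forall fun ω => tendsto_excess _)
    simpa using this
  have hfix : ∀ n, Tendsto (fun N => ∫⁻ ω in monoEvent M.S 0 n, excess N (M.S n ω) ∂(M.P x)) atTop
      (𝓝 0) := fun n => by
    have := tendsto_lintegral_of_dominated_convergence (μ := (M.P x).restrict (monoEvent M.S 0 n))
      (F := fun N ω => excess N (M.S n ω)) (f := 0) (fun ω => ENNReal.ofReal (M.S n ω))
      (fun N => (measurable_excess N).comp (M.measurable_S' n))
      (fun N => .of_forall fun ω => excess_le N _)
      (ne_top_of_le_ne_top (M.lintegral_S_ne_top hx n) (setLIntegral_le_lintegral _ _))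
      (.of_forall fun ω => tendsto_excess _)
    simpa using this
  have hiter : ∀ N n, (upStep M.K univ)^[n] (excess N) x
      = ∫⁻ ω in monoEvent M.S 0 n, excess N (M.S n ω) ∂(M.P x) := fun N n => by
    have := M.setLIntegral_monoEvent hx (j := 0) MeasurableSet.univ n (measurable_excess N)
    rw [univ_inter, Measure.restrict_univ, M.lintegral_S_zero hx, zero_add] at this
    exact this.symm
  have hbound : ∀ N n, ∫⁻ ω in monoEvent M.S 0 n, excess N (M.S n ω) ∂(M.P x)
      ≤ ∫⁻ ω in M.noDropEvent 0, excess N (M.Sinf ω) ∂(M.P x)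
        + ∫⁻ ω in monoEvent M.S 0 n \ M.noDropEvent 0, ENNReal.ofReal (M.S n ω) ∂(M.P x) := by
    intro N n
    rw [hsplit]
    refine add_le_add (lintegral_mono_ae ?_) (lintegral_mono fun ω => excess_le N _)
    filter_upwards [ae_restrict_mem hA, ae_restrict_of_ae (M.conv x hx)] with ω hω hconv
    have hmono : Monotone fun n => M.S n ω :=
      monotone_nat_of_le_succ fun n => hsub (n + 1) hω n (Nat.zero_le _) (Nat.lt_succ_self n)
    exact ENNReal.ofReal_le_ofReal (sub_le_sub_right (hmono.ge_of_tendsto hconv n) _)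
  refine ENNReal.tendsto_nhds_zero.2 fun ε hε => ?_
  have hε2 : 0 < ε / 2 := ENNReal.half_pos hε.ne'
  obtain ⟨n₀, hn₀⟩ := eventually_atTop.1 (ENNReal.tendsto_nhds_zero.1 hδ _ hε2)
  filter_upwards [ENNReal.tendsto_nhds_zero.1 he _ hε2,
    (Finset.eventually_all (Finset.range n₀)).2 fun n _ =>
      ENNReal.tendsto_nhds_zero.1 (hfix n) ε hε] with N hN hNfix
  refine iSup_le fun n => ?_
  rw [hiter]
  rcases lt_or_ge n n₀ with hn | hn
  · exact hNfix n (Finset.mem_range.2 hn)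
  · exact (hbound N n).trans ((add_le_add hN (hn₀ n hn)).trans (ENNReal.add_halves ε).le)

lemma lintegral_eq_tsum_fiber {μ : Measure Ω} {τ : Ω → ℕ∞}
    (hτ : ∀ t, MeasurableSet {ω | τ ω = t}) (f : Ω → ℝ≥0∞) :
    ∫⁻ ω, f ω ∂μ = ∑' t, ∫⁻ ω in {ω | τ ω = t}, f ω ∂μ := by
  have huniv : ⋃ t, {ω | τ ω = t} = univ := eq_univ_of_forall fun ω => mem_iUnion.2 ⟨τ ω, rfl⟩
  rw [← setLIntegral_univ, ← huniv, lintegral_iUnion hτ]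
  exact fun t t' hne => disjoint_left.2 fun ω h h' => hne (Eq.trans (Eq.symm h) h')

/-- If the expected excess vanishes in the limit from all positive starting points, then no mass
is lost at any drawdown. -/
lemma lintegral_evalAt_drawdown (hx : 0 < x)
    (h : ∀ y, 0 < y → Tendsto (fun N => supExcess M.K N y) atTop (𝓝 0)) (k : ℕ) :
    ∫⁻ ω, ENNReal.ofReal (evalAt M.S M.Sinf (drawdown M.S k) ω) ∂(M.P x) = ENNReal.ofReal x := by
  induction k with
  | zero => simpa [evalAt, drawdown] using M.lintegral_S_zero hx ENNReal.ofReal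
  | succ k ih =>
    have hτ := M.measurableSet_drawdown_eq k
    rw [← ih, lintegral_eq_tsum_fiber hτ, lintegral_eq_tsum_fiber hτ]
    refine tsum_congr fun t => ?_
    cases t with
    | top =>
      refine setLIntegral_congr_fun (hτ ⊤) fun ω (hω : _ = _) => ?_
      simp only [evalAt, hω, drawdown_succ_of_eq_top hω]
    | coe j =>
      calc _ = ∫⁻ ω in {ω | drawdown M.S k ω = (j : ℕ∞)},
            ENNReal.ofReal (evalAt M.S M.Sinf (drawdownAfter M.S j) ω) ∂(M.P x) :=
            setLIntegral_congr_fun (hτ j) fun ω (hω : _ = _) => by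
              simp only [evalAt, drawdown_succ_of_eq hω]
        _ = ∫⁻ ω in {ω | drawdown M.S k ω = (j : ℕ∞)}, ENNReal.ofReal (M.S j ω) ∂(M.P x) :=
            M.setLIntegral_evalAt_drawdownAfter_eq hx h (M.measurableSet_drawdown_eq_coe k j)
        _ = _ := setLIntegral_congr_fun (hτ j) fun ω (hω : _ = _) => by
              simp only [evalAt, hω, ENat.natCast_ne_top, if_false, ENat.toNat_natCast]

end markov

end MarkovMartingale

/-- If the default function vanishes on `[x', ∞)` for some `x' > 0`, then it
vanishes everywhere on `(0,∞)` and `P_x` is not a bubble measure for any `x > 0`. -/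
theorem MarkovMartingale.defaultFn_zero_propagates
    {Ω : Type*} [MeasurableSpace Ω] (M : MarkovMartingale Ω)
    {x' : ℝ} (hx' : 0 < x') (h0 : ∀ x : ℝ, x' ≤ x → M.defaultFn x = 0) :
    (∀ x : ℝ, 0 < x → M.defaultFn x = 0) ∧ (∀ x : ℝ, 0 < x → ¬ M.Bubble x) := by
  have := M.markov
  have hexc : ∀ y, 0 < y → Tendsto (fun N => supExcess M.K N y) atTop (nhds 0) := fun y hy =>
    tendsto_supExcess (fun _ => M.lintegral_kernel)
      (fun z hz => M.tendsto_supExcess_of_defaultFn_eq_zero (hx'.trans_le hz) (h0 z hz)) hy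
  have hE : ∀ x, 0 < x → ∀ k, ∫ ω, evalAt M.S M.Sinf (drawdown M.S k) ω ∂(M.P x) = x :=
    fun x hx k => by
      rw [M.integral_evalAt hx (M.measurableSet_drawdown_eq k),
        M.lintegral_evalAt_drawdown hx hexc k, ENNReal.toReal_ofReal hx.le]
  refine ⟨fun x hx => by rw [defaultFn, hE x hx 1, sub_self], ?_⟩
  rintro x hx ⟨k, hk⟩
  have := M.prob x hx
  rw [hE x hx (k + 1), integral_congr_ae (M.start x hx)] at hk
  simp at hk
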